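/- arXiv:2410.05840 — 3 statements merged into one kernel-verified Lean document; each statement's English description precedes it below -/
import Mathlib

section
/- Let V be a finite abelian group and a an automorphism of V of finite order such that V = [V,a], where [V,a] is the subgroup generated by all [v,a] = v⁻¹·a(v). Then in the semidirect product V ⋊ ⟨a⟩, for every positive integer k, every element of V is a γ_k-value, i.e., every v ∈ V can be written as a left-normed commutator [g₁,…,g_k] of k elements of V ⋊ ⟨a⟩. -/
/-- The commutator `[a,b] = a⁻¹ * b⁻¹ * a * b`. -/
def pcomm {G : Type*} [Group G] (a b : G) : G := a⁻¹ * b⁻¹ * a * b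

/-- The iterated Engel commutator `[g, ₙx]`, with `[g, ₀x] = g` and
`[g, ₙ₊₁x] = [[g, ₙx], x]`. -/
def engelComm {G : Type*} [Group G] (g x : G) : ℕ → G
  | 0 => g
  | n + 1 => pcomm (engelComm g x n) x

/-- `R` is a right Engel sink of `g`: for every `x` there is a positive integer `r`
such that `[g, ₙx] ∈ R` for all `n ≥ r`. -/
def IsRightEngelSink {G : Type*} [Group G] (g : G) (R : Set G) : Prop :=
  ∀ x : G, ∃ r : ℕ, 0 < r ∧ ∀ n : ℕ, r ≤ n → engelComm g x n ∈ R

/-- `R` is the smallest right Engel sink of `g`. -/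
def IsMinRightEngelSink {G : Type*} [Group G] (g : G) (R : Set G) : Prop :=
  IsRightEngelSink g R ∧ ∀ S : Set G, IsRightEngelSink g S → R ⊆ S

/-- The left-normed commutator `[g, x₁, x₂, …]` of `g` against a list. -/
def commFold {G : Type*} [Group G] (g : G) : List G → G
  | [] => g
  | x :: xs => commFold (pcomm g x) xs

/-- The left-normed commutator `[g₁, g₂, …, g_k]` of the entries of a list
(`1` for the empty list). -/
def commList {G : Type*} [Group G] : List G → G
  | [] => 1
  | x :: xs => commFold x xs

/-- `g` is a `γ_k`-value: a left-normed commutator `[g₁, …, g_k]` of `k` elements. -/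
def IsGammaValue {G : Type*} [Group G] (k : ℕ) (g : G) : Prop :=
  ∃ x : Fin k → G, g = commList (List.ofFn x)

/-- A group is locally nilpotent if every finitely generated subgroup is nilpotent. -/
def IsLocallyNilpotent (G : Type*) [Group G] : Prop :=
  ∀ S : Finset G, Group.IsNilpotent (Subgroup.closure (S : Set G))

/-- If the elements `v⁻¹ * a v` generate the abelian group `V`, then every element of `V` has
this form, since `v ↦ v⁻¹ * a v` is an endomorphism. -/
theorem exists_eq_inv_mul_apply_of_closure_eq_top {V : Type*} [CommGroup V] (a : MulAut V)
    (h : Subgroup.closure {w : V | ∃ v : V, w = v⁻¹ * a v} = ⊤) (w : V) :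
    ∃ v : V, v⁻¹ * a v = w := by
  let f : V →* V :=
    { toFun := fun v => v⁻¹ * a v
      map_one' := by simp
      map_mul' := fun x y => by rw [map_mul, mul_inv, mul_mul_mul_comm] }
  have hle : Subgroup.closure {w : V | ∃ v : V, w = v⁻¹ * a v} ≤ f.range := by
    rw [Subgroup.closure_le]
    rintro _ ⟨v, rfl⟩
    exact ⟨v, rfl⟩
  rw [h] at hle
  exact hle (Subgroup.mem_top w)

theorem pcomm_inl_inr_inv {N G : Type*} [Group N] [Group G] (φ : G →* MulAut N) (n : N) (g : G) :
    pcomm (SemidirectProduct.inl n : N ⋊[φ] G) (SemidirectProduct.inr g⁻¹) =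
      SemidirectProduct.inl (n⁻¹ * φ g n) := by
  rw [pcomm, map_mul, SemidirectProduct.inl_aut, map_inv, map_inv, inv_inv]
  simp only [mul_assoc]

theorem exists_commFold_inl_replicate_eq {N G : Type*} [Group N] [Group G] (φ : G →* MulAut N)
    (g : G) (hg : ∀ w : N, ∃ n : N, n⁻¹ * φ g n = w) (m : ℕ) (v : N) :
    ∃ w : N, commFold (SemidirectProduct.inl w : N ⋊[φ] G)
      (List.replicate m (SemidirectProduct.inr g⁻¹)) = SemidirectProduct.inl v := by
  induction m with
  | zero => exact ⟨v, rfl⟩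
  | succ m ih =>
    obtain ⟨w, hw⟩ := ih
    obtain ⟨n, rfl⟩ := hg w
    refine ⟨n, ?_⟩
    rw [List.replicate_succ, commFold, pcomm_inl_inr_inv, hw]

/-- **Lemma 2.4(b).** If `V` is a finite abelian group and `a` an automorphism (of finite
order) with `V = [V,a]`, then in the semidirect product `V ⋊ ⟨a⟩` every element of `V` is
a `γ_k`-value, for every positive integer `k`. -/
theorem every_element_gamma_value_in_semidirect (V : Type) [CommGroup V] [Finite V]
    (a : MulAut V) (hfin : IsOfFinOrder a)
    (h : Subgroup.closure {w : V | ∃ v : V, w = v⁻¹ * a v} = ⊤)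
    (k : ℕ) (hk : 0 < k) (v : V) :
    IsGammaValue k
      (SemidirectProduct.inl v :
        V ⋊[(Subgroup.zpowers a).subtype] ↥(Subgroup.zpowers a)) := by
  obtain ⟨m, rfl⟩ := Nat.exists_eq_succ_of_ne_zero hk.ne'
  let g : Subgroup.zpowers a := ⟨a, Subgroup.mem_zpowers a⟩
  obtain ⟨w, hw⟩ := exists_commFold_inl_replicate_eq (Subgroup.zpowers a).subtype g
    (exists_eq_inv_mul_apply_of_closure_eq_top a h) m v
  refine ⟨Fin.cons (SemidirectProduct.inl w) fun _ => SemidirectProduct.inr g⁻¹, ?_⟩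
  rw [List.ofFn_succ]
  simp only [Fin.cons_zero, Fin.cons_succ, List.ofFn_const, commList]
  exact hw.symm
end

section
/- Let p and q be distinct primes, let V be a finite elementary abelian q-group, and let g be an automorphism of V of order pᵗ (t ≥ 1) such that the fixed-point subgroup of g^{p^{t-1}} on V is trivial. Let m be a positive integer. If in the semidirect product V ⋊ ⟨g⟩ every element of V has a right Engel sink of cardinality at most m, then pᵗ ≤ m!. -/
/-- The endomap `v ↦ v⁻¹ * h⁻¹ v`, i.e. commutation of `v` with `h` in a semidirect product. -/
def commMap {V : Type*} [CommGroup V] (h : MulAut V) (v : V) : V := v⁻¹ * h⁻¹ v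

theorem commMap_injective {V : Type*} [CommGroup V] {h : MulAut V}
    (hfix : ∀ v : V, h v = v → v = 1) : Function.Injective (commMap h) := by
  intro v w hvw
  have key : h⁻¹ (v * w⁻¹) = v * w⁻¹ := by
    rw [map_mul, map_inv, eq_mul_of_inv_mul_eq (show v⁻¹ * h⁻¹ v = w⁻¹ * h⁻¹ w from hvw)]
    group
  have key' : h (v * w⁻¹) = v * w⁻¹ := by
    conv_lhs => rw [← key]
    exact MulAut.apply_inv_self _ h _
  exact mul_inv_eq_one.mp (hfix _ key')

theorem commMap_one {V : Type*} [CommGroup V] (h : MulAut V) : commMap h 1 = 1 := by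
  simp [commMap]

theorem pcomm_one_right {G : Type*} [Group G] (a : G) : pcomm a 1 = 1 := by
  simp [pcomm]

theorem engelComm_one_right {G : Type*} [Group G] (a : G) {n : ℕ} (hn : 0 < n) :
    engelComm a 1 n = 1 := by
  obtain ⟨k, rfl⟩ := Nat.exists_eq_succ_of_ne_zero hn.ne'
  exact pcomm_one_right _

theorem IsRightEngelSink.one_mem {G : Type*} [Group G] {a : G} {R : Set G}
    (hR : IsRightEngelSink a R) : (1 : G) ∈ R := by
  obtain ⟨r, hr, h⟩ := hR 1
  exact engelComm_one_right a hr ▸ h r le_rfl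

theorem engelComm_inl_inr {V H : Type*} [CommGroup V] [Group H] (φ : H →* MulAut V)
    (v : V) (x : H) (n : ℕ) :
    engelComm (SemidirectProduct.inl v : V ⋊[φ] H) (SemidirectProduct.inr x) n =
      SemidirectProduct.inl ((commMap (φ x))^[n] v) := by
  induction n with
  | zero => rfl
  | succ n ih =>
    rw [Function.iterate_succ_apply', engelComm, ih, pcomm, commMap]
    ext <;> simp

/-- If the values `f^[n] v` of an injective self-map of a finite type eventually lie in a finite
set of size at most `m`, then `v` is fixed by `f^[m!]`. -/
theorem iterate_factorial_of_eventually_mem {α : Type*} [Finite α] {f : α → α}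
    (hf : Function.Injective f) {v : α} {R : Finset α} {m r : ℕ}
    (hR : ∀ n, r ≤ n → f^[n] v ∈ R) (hm : R.card ≤ m) : f^[m.factorial] v = v := by
  have hpos : 0 < Function.minimalPeriod f v :=
    Function.minimalPeriod_pos_of_mem_periodicPts (hf.mem_periodicPts v)
  have hle : Function.minimalPeriod f v ≤ m := by
    refine le_trans ?_ hm
    rw [← Finset.card_range (Function.minimalPeriod f v)]
    refine Finset.card_le_card_of_injOn (fun i => f^[r + i] v)
      (fun i _ => hR _ (Nat.le_add_right r i)) ?_
    intro i hi j hj hij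
    simp only [Function.iterate_add_apply] at hij
    exact Function.iterate_injOn_Iio_minimalPeriod (by simpa using hi) (by simpa using hj)
      (hf.iterate r hij)
  exact (Function.isPeriodicPt_minimalPeriod f v).trans_dvd (Nat.dvd_factorial hpos hle)

/-- If commutation with `g` and with `g⁻¹` both have order dividing an even number `N`, then so
does `g`. -/
theorem pow_eq_one_of_commMap_iterate {V : Type*} [CommGroup V] {g : MulAut V} {N : ℕ}
    (hN : Even N) (h₁ : ∀ v, (commMap g)^[N] v = v) (h₂ : ∀ v, (commMap g⁻¹)^[N] v = v) :
    g ^ N = 1 := by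
  have hcomp : commMap g⁻¹ = (fun v => (g v)⁻¹) ∘ commMap g := by
    funext v
    simp [commMap, mul_comm]
  have hcomm : Function.Commute (fun v => (g v)⁻¹) (commMap g) := by
    intro v
    simp [commMap, mul_comm]
  have hinv : Function.Commute (fun v : V => v⁻¹) g := fun v => (map_inv g v).symm
  have hc : (fun v => (g v)⁻¹) = (fun v : V => v⁻¹) ∘ g := rfl
  ext v
  have h := h₂ v
  rw [hcomp, hcomm.comp_iterate, Function.comp_apply, h₁, hc, hinv.comp_iterate,
    Function.comp_apply,
    (show Function.Involutive (fun v : V => v⁻¹) from inv_inv).iterate_even hN] at h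
  have hg : ∀ n : ℕ, (g ^ n) v = g^[n] v := by
    intro n
    induction n with
    | zero => rfl
    | succ n ih => rw [pow_succ', MulAut.mul_apply, ih, Function.iterate_succ_apply']
  rw [hg]
  exact h

/-- **Lemma (exponent bound, cf. Lemma 3.4).** Let `p ≠ q` be primes, `V` a finite
elementary abelian `q`-group, and `g` an automorphism of `V` of order `p^t` (`t ≥ 1`)
such that `g^(p^(t-1))` has no non-trivial fixed points on `V`. If in `V ⋊ ⟨g⟩` every
element of `V` has a right Engel sink of cardinality at most `m`, then `p^t ≤ m!`. -/
theorem order_bound_of_bounded_sinks (p q : ℕ) (hp : p.Prime) (hq : q.Prime)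
    (hpq : p ≠ q) (V : Type) [CommGroup V] [Finite V]
    (helem : ∀ v : V, v ≠ 1 → orderOf v = q)
    (t : ℕ) (ht : 1 ≤ t) (g : MulAut V) (hord : orderOf g = p ^ t)
    (hfix : ∀ v : V, (g ^ p ^ (t - 1)) v = v → v = 1)
    (m : ℕ) (hm : 0 < m)
    (hsink : ∀ v : V,
      ∃ R : Finset (V ⋊[(Subgroup.zpowers g).subtype] ↥(Subgroup.zpowers g)),
        IsRightEngelSink (SemidirectProduct.inl v) (↑R : Set (V ⋊[(Subgroup.zpowers g).subtype] ↥(Subgroup.zpowers g))) ∧ R.card ≤ m) :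
    p ^ t ≤ Nat.factorial m := by
  have hfixg : ∀ v : V, g v = v → v = 1 := by
    intro v hv
    refine hfix v ?_
    generalize p ^ (t - 1) = n
    induction n with
    | zero => rfl
    | succ n ih => rw [pow_succ, MulAut.mul_apply, hv, ih]
  have hfixg' : ∀ v : V, g⁻¹ v = v → v = 1 := by
    intro v hv
    refine hfixg v ?_
    conv_lhs => rw [← hv]
    exact MulAut.apply_inv_self _ g _
  have hiter : ∀ (x : Subgroup.zpowers g), (∀ v : V, (x : MulAut V) v = v → v = 1) →
      ∀ v, (commMap (x : MulAut V))^[m.factorial] v = v := by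
    intro x hx v
    classical
    obtain ⟨R, hR, hcard⟩ := hsink v
    obtain ⟨r, -, hr⟩ := hR (SemidirectProduct.inr x)
    refine iterate_factorial_of_eventually_mem (commMap_injective hx)
      (R := R.image SemidirectProduct.left) (r := r) ?_ (Finset.card_image_le.trans hcard)
    intro n hn
    have := hr n hn
    rw [engelComm_inl_inr] at this
    exact Finset.mem_image.mpr ⟨_, this, rfl⟩
  have hg1 : g ≠ 1 := by
    rintro rfl
    rw [orderOf_one] at hord
    exact (Nat.one_lt_pow (by omega) hp.one_lt).ne hord
  obtain ⟨v, hv⟩ : ∃ v : V, v ≠ 1 := by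
    by_contra! hV
    exact hg1 (MulEquiv.ext fun v => (hV _).trans (hV _).symm)
  have hm2 : 2 ≤ m := by
    obtain ⟨R, hR, hcard⟩ := hsink v
    obtain ⟨r, -, hr⟩ := hR (SemidirectProduct.inr ⟨g, Subgroup.mem_zpowers g⟩)
    have h := hr r le_rfl
    rw [engelComm_inl_inr] at h
    refine le_trans (Finset.one_lt_card.mpr ⟨_, h, 1, hR.one_mem, ?_⟩) hcard
    intro heq
    rw [← map_one SemidirectProduct.inl] at heq
    refine hv (((commMap_injective hfixg).iterate r) ?_)
    rw [Function.iterate_fixed (commMap_one g)]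
    exact SemidirectProduct.inl_injective heq
  have hpow := pow_eq_one_of_commMap_iterate
    (even_iff_two_dvd.mpr (Nat.dvd_factorial two_pos hm2))
    (hiter ⟨g, Subgroup.mem_zpowers g⟩ hfixg)
    (hiter ⟨g⁻¹, inv_mem (Subgroup.mem_zpowers g)⟩ hfixg')
  exact hord ▸ Nat.le_of_dvd m.factorial_pos (orderOf_dvd_of_pow_eq_one hpow)
end

section
/- There exists a function f : ℕ → ℕ such that for every positive integer k the following holds: if p is a prime, V is a finite abelian group of order coprime to p, P is a finite p-group acting faithfully by automorphisms on V, and every γ_k-value in the semidirect product V ⋊ P has a right Engel sink of cardinality at most m, then the (Prüfer) rank of P is at most f(m). -/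
open scoped Nat in
/-- If a finite group `P` acts faithfully and coprimely on a finite abelian group `V` and every
element of the form `x • v - v` has a `P`-orbit of size at most `m`, then `|P| ≤ m!`. -/
theorem card_le_factorial_of_card_orbit_le {P V : Type*} [Group P] [Finite P] [AddCommGroup V]
    [DistribMulAction P V] [FaithfulSMul P V]
    (hcop : (Nat.card V).Coprime (Nat.card P)) {m : ℕ}
    (horb : ∀ (x : P) (v : V), Nat.card (MulAction.orbit P (x • v - v)) ≤ m) :
    Nat.card P ≤ m ! := by
  classical
  have hbdd : BddAbove (Set.range fun a : P × V ↦
      Nat.card (MulAction.orbit P (a.1 • a.2 - a.2))) :=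
    ⟨m, by rintro _ ⟨a, rfl⟩; exact horb a.1 a.2⟩
  obtain ⟨⟨x, v₀⟩, hmax⟩ := Nat.sSup_mem (Set.range_nonempty _) hbdd
  replace hmax : ∀ (y : P) (v : V), Nat.card (MulAction.orbit P (y • v - v)) ≤
      Nat.card (MulAction.orbit P (x • v₀ - v₀)) := fun y v ↦
    (le_csSup hbdd ⟨(y, v), rfl⟩).trans hmax.ge
  set u : V := x • v₀ - v₀ with hu
  have : Finite (MulAction.orbit P u) := Set.finite_range _
  suffices hinj : Function.Injective (MulAction.toPermHom P (MulAction.orbit P u)) by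
    calc Nat.card P ≤ Nat.card (Equiv.Perm (MulAction.orbit P u)) :=
          Nat.card_le_card_of_injective _ hinj
      _ = (Nat.card (MulAction.orbit P u))! := Nat.card_perm
      _ ≤ m ! := Nat.factorial_le (horb x v₀)
  rw [← MonoidHom.ker_eq_bot_iff, Subgroup.eq_bot_iff_forall]
  set N : Subgroup P := (MulAction.toPermHom P (MulAction.orbit P u)).ker
  have : N.Normal := MonoidHom.normal_ker _
  have hNu : ∀ n ∈ N, n • u = u := fun n hn ↦ by
    have h := Equiv.congr_fun (MonoidHom.mem_ker.mp hn) ⟨u, MulAction.mem_orbit_self u⟩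
    exact congrArg Subtype.val h
  intro n hn
  by_contra hn1
  obtain ⟨t, ht⟩ : ∃ t : ℤ, ∀ v : V, t • Nat.card N • v = v := by
    have hc : (Nat.card N).Coprime (Nat.card V) :=
      (hcop.coprime_dvd_right N.card_subgroup_dvd_card).symm
    refine ⟨(Nat.card N).gcdA (Nat.card V), fun v ↦ ?_⟩
    have hb := Nat.gcd_eq_gcd_ab (Nat.card N) (Nat.card V)
    rw [hc, Nat.cast_one] at hb
    have hV : (Nat.card V : ℤ) • v = 0 := by rw [natCast_zsmul, card_nsmul_eq_zero']
    rw [← natCast_zsmul, smul_smul]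
    nth_rewrite 2 [← one_zsmul v]
    rw [hb, add_zsmul, mul_comm, mul_comm (Nat.card V : ℤ), mul_zsmul v _ (Nat.card V : ℤ), hV,
      smul_zero, add_zero]
  have := Fintype.ofFinite N
  let π : V →+ V := t • ∑ a : N, DistribSMul.toAddMonoidHom V (a : P)
  have hπ : ∀ v, π v = t • ∑ a : N, (a : P) • v := fun v ↦ by simp [π]
  have hπ_fix : ∀ v, (∀ a ∈ N, a • v = v) → π v = v := fun v hv ↦ by
    rw [hπ, Finset.sum_congr rfl fun (a : N) _ ↦ hv a a.2]
    simpa using ht v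
  have hfix_π : ∀ v, ∀ a ∈ N, a • π v = π v := fun v a ha ↦ by
    rw [hπ, smul_comm, Finset.smul_sum]
    congr 1
    exact Fintype.sum_equiv (Equiv.mulLeft ⟨a, ha⟩) _ _ fun b ↦ by simp [mul_smul]
  have hπ_comm : ∀ (g : P) v, π (g • v) = g • π v := fun g v ↦ by
    rw [hπ, hπ, smul_comm g t, Finset.smul_sum (r := g)]
    congr 1
    refine Fintype.sum_equiv (MulAut.conjNormal (H := N) g⁻¹).toEquiv (fun b ↦ (b : P) • g • v)
      (fun b ↦ g • (b : P) • v) fun b ↦ ?_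
    simp [mul_smul]
  obtain ⟨v₁, hv₁⟩ : ∃ v₁ : V, n • v₁ ≠ v₁ := by
    by_contra! h
    exact hn1 (FaithfulSMul.eq_of_smul_eq_smul (α := V) fun v ↦ by simp [h v])
  obtain ⟨w₁, hw₁, hnw₁⟩ : ∃ w₁ : V, π w₁ = 0 ∧ n • w₁ ≠ w₁ := by
    refine ⟨v₁ - π v₁, ?_, ?_⟩
    · rw [map_sub, hπ_fix _ (hfix_π v₁), sub_self]
    · rw [smul_sub, hfix_π v₁ n hn]
      simpa using hv₁
  obtain ⟨a, ha, hyw₁⟩ : ∃ a ∈ N, (x * a) • w₁ ≠ w₁ := by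
    by_contra! h
    have h1 := h 1 N.one_mem
    have h2 := h n hn
    rw [mul_one] at h1
    rw [mul_smul] at h2
    exact hnw₁ (MulAction.injective x (h2.trans h1.symm))
  set w : V := (x * a) • w₁ - w₁ with hw
  have hw0 : w ≠ 0 := sub_ne_zero.mpr hyw₁
  have hπw : π w = 0 := by rw [hw, map_sub, hπ_comm, hw₁, smul_zero, sub_zero]
  have huw : (x * a) • (π v₀ + w₁) - (π v₀ + w₁) = u + w := by
    have : x • π v₀ - π v₀ = u := by
      rw [← hπ_comm, ← map_sub, hπ_fix _ hNu]
    rw [smul_add, mul_smul x a (π v₀), hfix_π v₀ a ha, ← this, hw]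
    abel
  have hle : MulAction.stabilizer P (u + w) ≤ MulAction.stabilizer P u := fun g hg ↦ by
    have := congrArg π (MulAction.mem_stabilizer_iff.mp hg)
    rwa [hπ_comm, map_add, hπ_fix _ hNu, hπw, add_zero] at this
  have hlt : MulAction.stabilizer P (u + w) < MulAction.stabilizer P u := by
    refine lt_of_le_of_ne hle fun heq ↦ hw0 ?_
    rw [← hπ_fix w, hπw]
    intro b hb
    have h1 : b ∈ MulAction.stabilizer P (u + w) := heq ▸ hNu b hb
    have h2 : b • (u + w) = u + w := h1
    rwa [smul_add, hNu b hb, add_right_inj] at h2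
  have hcard := hmax (x * a) (π v₀ + w₁)
  rw [huw] at hcard
  have h1 := (MulAction.stabilizer P (u + w)).card_mul_index
  have h2 := (MulAction.stabilizer P u).card_mul_index
  rw [MulAction.index_stabilizer] at h1 h2
  have h3 : Nat.card (MulAction.stabilizer P (u + w)) < Nat.card (MulAction.stabilizer P u) :=
    Set.ncard_lt_ncard hlt
  have h4 : 0 < (MulAction.orbit P u).ncard :=
    (Set.ncard_pos (Set.finite_range _)).mpr ⟨u, MulAction.mem_orbit_self u⟩
  change (MulAction.orbit P (u + w)).ncard ≤ (MulAction.orbit P u).ncard at hcard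
  nlinarith

/-- The map `v ↦ y • v - v` as an additive endomorphism. -/
def smulSubSelf {P : Type*} (V : Type*) [Group P] [AddCommGroup V] [DistribMulAction P V] (y : P) :
    AddMonoid.End V :=
  DistribSMul.toAddMonoidHom V y - AddMonoidHom.id V

theorem smulSubSelf_apply {P V : Type*} [Group P] [AddCommGroup V] [DistribMulAction P V]
    (y : P) (v : V) : smulSubSelf V y v = y • v - v :=
  rfl

theorem smulSubSelf_eq_zero_of_apply_apply {P V : Type*} [Group P] [AddCommGroup V]
    [DistribMulAction P V] (hcop : (Nat.card V).Coprime (Nat.card P)) (y : P) {v : V}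
    (h : smulSubSelf V y (smulSubSelf V y v) = 0) : smulSubSelf V y v = 0 := by
  have hfix : y • smulSubSelf V y v = smulSubSelf V y v := sub_eq_zero.mp h
  have hpow : ∀ j : ℕ, y ^ j • v = v + j • smulSubSelf V y v := fun j ↦ by
    induction j with
    | zero => simp
    | succ j ih =>
      have hfix' : y • j • smulSubSelf V y v = j • smulSubSelf V y v := by
        rw [smul_comm, hfix]
      rw [pow_succ', mul_smul, ih, smul_add, hfix', succ_nsmul, smulSubSelf_apply]
      abel
  have h1 := hpow (Nat.card P)
  rw [pow_card_eq_one', one_smul, left_eq_add] at h1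
  have h2 : Nat.card V • smulSubSelf V y v = 0 := card_nsmul_eq_zero'
  rw [← AddMonoid.addOrderOf_eq_one_iff, ← Nat.dvd_one, ← hcop]
  exact Nat.dvd_gcd (addOrderOf_dvd_of_nsmul_eq_zero h2) (addOrderOf_dvd_of_nsmul_eq_zero h1)

theorem exists_smulSubSelf_pow_mul_self {P V : Type*} [Group P] [AddCommGroup V] [Finite V]
    [DistribMulAction P V] (hcop : (Nat.card V).Coprime (Nat.card P)) (y : P) :
    ∃ q : ℕ, 0 < q ∧ ∀ s : ℕ, smulSubSelf V y ^ (q * s) * smulSubSelf V y = smulSubSelf V y := by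
  set D := smulSubSelf V y
  have : Finite (AddMonoid.End V) := DFunLike.finite _
  have hdesc : ∀ (i : ℕ) (w : V), (D ^ i) w = 0 → D w = 0 := fun i ↦ by
    induction i with
    | zero => intro w hw; simpa using congrArg D hw
    | succ i ih =>
      intro w hw
      rw [pow_succ] at hw
      exact smulSubSelf_eq_zero_of_apply_apply hcop y (ih _ hw)
  obtain ⟨i, j, hij, heq⟩ : ∃ i j : ℕ, i < j ∧ D ^ i = D ^ j := by
    obtain ⟨i, j, hne, heq⟩ := Finite.exists_ne_map_eq_of_infinite fun n : ℕ ↦ D ^ n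
    rcases hne.lt_or_gt with h | h
    exacts [⟨i, j, h, heq⟩, ⟨j, i, h, heq.symm⟩]
  obtain ⟨q, rfl⟩ := Nat.exists_eq_add_of_lt hij
  have hq : D ^ (q + 1) * D = D := by
    rw [← pow_succ, pow_succ']
    refine AddMonoidHom.ext fun v ↦ sub_eq_zero.mp ?_
    have h0 := hdesc i ((D ^ (q + 1)) v - v) (by
      rw [map_sub, sub_eq_zero]
      have := DFunLike.congr_fun heq v
      rw [add_assoc, pow_add] at this
      exact this.symm)
    rwa [map_sub] at h0
  refine ⟨q + 1, q.succ_pos, fun s ↦ ?_⟩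
  induction s with
  | zero => simp
  | succ s ih => rw [Nat.mul_succ, pow_add, mul_assoc, hq, ih]

theorem engelComm_pcomm {G : Type*} [Group G] (g x : G) (n : ℕ) :
    engelComm (pcomm g x) x n = engelComm g x (n + 1) := by
  induction n with
  | zero => rfl
  | succ n ih => rw [engelComm, ih, ← engelComm]

theorem commFold_replicate {G : Type*} [Group G] (g x : G) (n : ℕ) :
    commFold g (List.replicate n x) = engelComm g x n := by
  induction n generalizing g with
  | zero => rfl
  | succ n ih => rw [List.replicate_succ, commFold, ih, engelComm_pcomm]

theorem isGammaValue_engelComm {G : Type*} [Group G] (g x : G) (n : ℕ) :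
    IsGammaValue (n + 1) (engelComm g x n) :=
  ⟨Fin.cons g fun _ ↦ x, by
    simp [List.ofFn_succ, List.ofFn_const, commList, commFold_replicate]⟩

/-- **Lemma (rank bound, cf. Lemma 3.5).** There is a function `f` such that if a finite
`p`-group `P` acts faithfully on a finite abelian group `V` of order coprime to `p`, and
in `V ⋊ P` every `γ_k`-value has a right Engel sink of cardinality at most `m`, then the
(Prüfer) rank of `P` is at most `f m`: every subgroup of `P` is generated by at most
`f m` elements. -/
theorem rank_bound_of_bounded_sinks :
    ∃ f : ℕ → ℕ, ∀ k m : ℕ, 0 < k → 0 < m →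
      ∀ (p : ℕ), p.Prime →
      ∀ (V : Type) [CommGroup V] [Finite V],
      ∀ (P : Type) [Group P] [Finite P],
      ∀ (φ : P →* MulAut V),
        IsPGroup p P →
        Nat.Coprime (Nat.card V) p →
        Function.Injective φ →
        (∀ g : V ⋊[φ] P, IsGammaValue k g →
          ∃ R : Finset (V ⋊[φ] P), IsRightEngelSink g (↑R : Set (V ⋊[φ] P)) ∧
            R.card ≤ m) →
        ∀ H : Subgroup P, ∃ S : Finset P, (↑S : Set P) ⊆ (H : Set P) ∧
          Subgroup.closure (↑S : Set P) = H ∧ S.card ≤ f m := by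
  refine ⟨fun m ↦ m.factorial, fun k m hk _ p hp V _ _ P _ _ φ hP hcop hφ hsink H ↦ ?_⟩
  let _ : DistribMulAction P (Additive V) :=
    { smul := fun y v ↦ Additive.ofMul (φ y v.toMul)
      one_smul := fun v ↦ congrArg (fun e : MulAut V ↦ Additive.ofMul (e v.toMul)) (map_one φ)
      mul_smul := fun y z v ↦
        congrArg (fun e : MulAut V ↦ Additive.ofMul (e v.toMul)) (map_mul φ y z)
      smul_zero := fun y ↦ congrArg Additive.ofMul (map_one (φ y))
      smul_add := fun y v w ↦ congrArg Additive.ofMul (map_mul (φ y) v.toMul w.toMul) }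
  have hsmul : ∀ (y : P) (v : Additive V), y • v = Additive.ofMul (φ y v.toMul) := fun _ _ ↦ rfl
  have : FaithfulSMul P (Additive V) := ⟨fun h ↦ hφ (MulEquiv.ext h)⟩
  have hcop' : (Nat.card (Additive V)).Coprime (Nat.card P) := by
    have : Fact p.Prime := ⟨hp⟩
    obtain ⟨n, hn⟩ := hP.exists_card_eq
    rw [hn]
    exact hcop.pow_right n
  let ι : Additive V → V ⋊[φ] P := fun v ↦ SemidirectProduct.inl v.toMul
  have hι : Function.Injective ι := SemidirectProduct.inl_injective.comp Additive.toMul.injective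
  have hengel : ∀ (v : Additive V) (y : P) (n : ℕ),
      engelComm (ι v) (SemidirectProduct.inr y⁻¹) n = ι ((smulSubSelf (Additive V) y ^ n) v) := by
    intro v y n
    induction n with
    | zero => rfl
    | succ n ih =>
      rw [engelComm, ih, pow_succ']
      change pcomm (ι _) _ = ι (smulSubSelf (Additive V) y ((smulSubSelf (Additive V) y ^ n) v))
      generalize (smulSubSelf (Additive V) y ^ n) v = w
      rw [smulSubSelf_apply]
      ext <;> simp [pcomm, ι, hsmul, div_eq_mul_inv, mul_comm]
  have horb : ∀ (x : P) (v : Additive V), Nat.card (MulAction.orbit P (x • v - v)) ≤ m := by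
    intro x v
    rw [← smulSubSelf_apply]
    set u := smulSubSelf (Additive V) x v
    have hval : IsGammaValue k (ι u) := by
      obtain ⟨q, hq, hpow⟩ := exists_smulSubSelf_pow_mul_self hcop' x
      obtain ⟨j, rfl⟩ := Nat.exists_eq_add_of_lt hk
      obtain ⟨c, hc⟩ := Nat.exists_eq_add_of_le (Nat.le_mul_of_pos_left j hq)
      have hu' : u = (smulSubSelf (Additive V) x ^ j)
          ((smulSubSelf (Additive V) x ^ (c + 1)) v) := by
        change u = (smulSubSelf (Additive V) x ^ j * smulSubSelf (Additive V) x ^ (c + 1)) v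
        rw [← pow_add, ← add_assoc, ← hc, pow_succ, hpow]
      rw [hu', ← hengel, Nat.zero_add]
      exact isGammaValue_engelComm _ _ _
    obtain ⟨R, hR, hRcard⟩ := hsink _ hval
    have hmem : ∀ y : P, ι (y • u - u) ∈ R := fun y ↦ by
      obtain ⟨r, _, hr⟩ := hR (SemidirectProduct.inr y⁻¹)
      obtain ⟨q, hq, hpow⟩ := exists_smulSubSelf_pow_mul_self hcop' y
      have := hr (q * r + 1) (by nlinarith)
      rwa [hengel, pow_succ, hpow] at this
    calc Nat.card (MulAction.orbit P u) ≤ Nat.card R := by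
          refine Nat.card_le_card_of_injective
            (fun w ↦ (⟨ι (w - u), by obtain ⟨_, y, rfl⟩ := w; exact hmem y⟩ : R)) ?_
          intro w₁ w₂ h
          exact Subtype.ext (sub_left_injective (hι (congrArg Subtype.val h)))
      _ ≤ m := by simpa using hRcard
  classical
  have := Fintype.ofFinite P
  refine ⟨(H : Set P).toFinset, by simp, by simp, ?_⟩
  calc (H : Set P).toFinset.card ≤ Fintype.card P := Finset.card_le_univ _
    _ = Nat.card P := Nat.card_eq_fintype_card.symm
    _ ≤ m.factorial := card_le_factorial_of_card_orbit_le hcop' horb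
end
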